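/- (Onsager-type identity.) Assume S is a finite set, ξ, η : S → ℤ, r : S×S×S×S → [0,∞) satisfies condition (A), π is a probability measure on S satisfying condition (C), and condition (D) holds. Then the macroscopic fluxes Φ, Ψ : ℝ² → ℝ are differentiable and satisfy ∂Φ/∂τ (θ,τ) = ∂Ψ/∂θ (θ,τ) for every (θ,τ) ∈ ℝ². -/

import Mathlib

open scoped BigOperators

/-- The single-site Gibbs measure `π_{θ,τ}(ω) = π(ω) exp(θξ(ω)+τη(ω)−G(θ,τ))`,
where `G(θ,τ) = log Σ_ω e^{θξ(ω)+τη(ω)} π(ω)`. -/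
noncomputable def gibbsMeasure {S : Type*} [Fintype S]
    (π : S → ℝ) (ξ η : S → ℤ) (θ τ : ℝ) (ω : S) : ℝ :=
  π ω * Real.exp (θ * (ξ ω : ℝ) + τ * (η ω : ℝ) -
    Real.log (∑ ω' : S, Real.exp (θ * (ξ ω' : ℝ) + τ * (η ω' : ℝ)) * π ω'))

/-- The macroscopic flux of the conserved quantity `g`:
`(θ,τ) ↦ Σ r(ω₁,ω₂;ω₁',ω₂')(g(ω₂')−g(ω₂)) π_{θ,τ}(ω₁) π_{θ,τ}(ω₂)`. -/
noncomputable def macroFlux {S : Type*} [Fintype S]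
    (r : S → S → S → S → ℝ) (π : S → ℝ) (ξ η g : S → ℤ) (p : ℝ × ℝ) : ℝ :=
  ∑ ω₁ : S, ∑ ω₂ : S,
    (∑ ω₁' : S, ∑ ω₂' : S, r ω₁ ω₂ ω₁' ω₂' * ((g ω₂' : ℝ) - (g ω₂ : ℝ))) *
      gibbsMeasure π ξ η p.1 p.2 ω₁ * gibbsMeasure π ξ η p.1 p.2 ω₂

theorem sum4_rev {S : Type*} [Fintype S] (f : S → S → S → S → ℝ) :
    ∑ a, ∑ b, ∑ c, ∑ d, f a b c d = ∑ a, ∑ b, ∑ c, ∑ d, f d c b a := by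
  have e : ∀ g : S → S → S → S → ℝ, ∑ a, ∑ b, ∑ c, ∑ d, g a b c d
      = ∑ x : (S × S) × (S × S), g x.1.1 x.1.2 x.2.1 x.2.2 := by
    intro g
    simp only [Fintype.sum_prod_type]
  rw [e, e]
  refine Fintype.sum_equiv
    ⟨fun x => ((x.2.2, x.2.1), (x.1.2, x.1.1)), fun x => ((x.2.2, x.2.1), (x.1.2, x.1.1)),
      fun _ => rfl, fun _ => rfl⟩ _ _ ?_
  intro x
  rfl

theorem flux_step {S : Type*} [Fintype S] (r : S → S → S → S → ℝ) (m X Y : S → ℝ)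
    (hY : ∀ a b c d, r a b c d * (Y a + Y b) = r a b c d * (Y c + Y d))
    (hC : ∀ a b c d, m a * m b * r a b c d = m d * m c * r d c b a) :
    ∑ a, ∑ b, (∑ c, ∑ d, r a b c d * (X d - X b)) * m a * m b * (Y a + Y b)
      = ∑ a, ∑ b, (∑ c, ∑ d, r a b c d) * (m a * m b * ((X a - X b) * (Y a + Y b))) := by
  have h1 : ∑ a, ∑ b, ∑ c, ∑ d, m a * m b * r a b c d * (X d * (Y a + Y b))
      = ∑ a, ∑ b, ∑ c, ∑ d, m a * m b * r a b c d * (X a * (Y a + Y b)) := by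
    rw [sum4_rev]
    refine Finset.sum_congr rfl fun a _ => Finset.sum_congr rfl fun b _ =>
      Finset.sum_congr rfl fun c _ => Finset.sum_congr rfl fun d _ => ?_
    rw [← hC a b c d]
    linear_combination (- m a * m b * X a) * hY a b c d
  have h2 : ∑ a, ∑ b, (∑ c, ∑ d, r a b c d * (X d - X b)) * m a * m b * (Y a + Y b)
      = ∑ a, ∑ b, ∑ c, ∑ d, m a * m b * r a b c d * (X d * (Y a + Y b))
        - ∑ a, ∑ b, ∑ c, ∑ d, m a * m b * r a b c d * (X b * (Y a + Y b)) := by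
    simp only [Finset.sum_mul, ← Finset.sum_sub_distrib]
    refine Finset.sum_congr rfl fun a _ => Finset.sum_congr rfl fun b _ =>
      Finset.sum_congr rfl fun c _ => Finset.sum_congr rfl fun d _ => ?_
    ring
  rw [h2, h1]
  simp only [Finset.sum_mul, ← Finset.sum_sub_distrib]
  refine Finset.sum_congr rfl fun a _ => Finset.sum_congr rfl fun b _ =>
    Finset.sum_congr rfl fun c _ => Finset.sum_congr rfl fun d _ => ?_
  ring

theorem antisymm_step {S : Type*} [Fintype S] [Nonempty S] (R : S → S → ℝ) (m X Y : S → ℝ)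
    (hD : ∀ a b c, R a b + R b c + R c a = R a c + R c b + R b a)
    (hX : ∑ a, m a * X a = 0) (hY : ∑ a, m a * Y a = 0) :
    ∑ a, ∑ b, R a b * (m a * m b * ((X a - X b) * (Y a + Y b)))
      = ∑ a, ∑ b, R a b * (m a * m b * ((Y a - Y b) * (X a + X b))) := by
  obtain ⟨s⟩ := ‹Nonempty S›
  set k : S → ℝ := fun x => R x s - R s x with hk
  have h1 : ∑ a, ∑ b, R a b * (m a * m b * (X a * Y b - X b * Y a))
      = - ∑ a, ∑ b, R b a * (m a * m b * (X a * Y b - X b * Y a)) := by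
    rw [Finset.sum_comm]
    simp only [← Finset.sum_neg_distrib]
    refine Finset.sum_congr rfl fun a _ => Finset.sum_congr rfl fun b _ => ?_
    ring
  have h2 : ∑ a, ∑ b, R a b * (m a * m b * (X a * Y b - X b * Y a))
      - ∑ a, ∑ b, R b a * (m a * m b * (X a * Y b - X b * Y a)) = 0 := by
    have : ∑ a, ∑ b, R a b * (m a * m b * (X a * Y b - X b * Y a))
      - ∑ a, ∑ b, R b a * (m a * m b * (X a * Y b - X b * Y a))
      = (∑ a, k a * (m a * X a)) * (∑ b, m b * Y b)
        - (∑ a, k a * (m a * Y a)) * (∑ b, m b * X b)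
        - (∑ a, m a * X a) * (∑ b, k b * (m b * Y b))
        + (∑ a, m a * Y a) * (∑ b, k b * (m b * X b)) := by
      simp only [Finset.sum_mul_sum, ← Finset.sum_sub_distrib, ← Finset.sum_add_distrib]
      refine Finset.sum_congr rfl fun a _ => Finset.sum_congr rfl fun b _ => ?_
      simp only [hk]
      linear_combination (m a * m b * (X a * Y b - X b * Y a)) * hD a b s
    rw [this, hX, hY]
    ring
  have h3 : ∑ a, ∑ b, R a b * (m a * m b * ((X a - X b) * (Y a + Y b)))
      - ∑ a, ∑ b, R a b * (m a * m b * ((Y a - Y b) * (X a + X b)))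
      = 2 * ∑ a, ∑ b, R a b * (m a * m b * (X a * Y b - X b * Y a)) := by
    simp only [Finset.mul_sum, ← Finset.sum_sub_distrib]
    refine Finset.sum_congr rfl fun a _ => Finset.sum_congr rfl fun b _ => ?_
    ring
  linarith

theorem partition_pos {S : Type*} [Fintype S] (π : S → ℝ) (ξ η : S → ℤ)
    (hπ0 : ∀ ω : S, 0 ≤ π ω) (hπ1 : ∑ ω : S, π ω = 1) (θ τ : ℝ) :
    0 < ∑ ω' : S, Real.exp (θ * (ξ ω' : ℝ) + τ * (η ω' : ℝ)) * π ω' := by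
  have h : ∃ a, 0 < π a := by
    by_contra! h
    have : ∑ ω : S, π ω ≤ 0 := Finset.sum_nonpos fun a _ => h a
    linarith
  obtain ⟨a, ha⟩ := h
  exact Finset.sum_pos' (fun i _ => mul_nonneg (Real.exp_pos _).le (hπ0 i))
    ⟨a, Finset.mem_univ _, mul_pos (Real.exp_pos _) ha⟩

theorem gibbs_eq {S : Type*} [Fintype S] (π : S → ℝ) (ξ η : S → ℤ)
    (hπ0 : ∀ ω : S, 0 ≤ π ω) (hπ1 : ∑ ω : S, π ω = 1) (θ τ : ℝ) (ω : S) :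
    gibbsMeasure π ξ η θ τ ω = Real.exp (θ * (ξ ω : ℝ) + τ * (η ω : ℝ)) * π ω /
      ∑ ω' : S, Real.exp (θ * (ξ ω' : ℝ) + τ * (η ω' : ℝ)) * π ω' := by
  unfold gibbsMeasure
  rw [Real.exp_sub, Real.exp_log (partition_pos π ξ η hπ0 hπ1 θ τ)]
  ring

theorem gibbs_sum {S : Type*} [Fintype S] (π : S → ℝ) (ξ η : S → ℤ)
    (hπ0 : ∀ ω : S, 0 ≤ π ω) (hπ1 : ∑ ω : S, π ω = 1) (θ τ : ℝ) :
    ∑ ω, gibbsMeasure π ξ η θ τ ω = 1 := by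
  simp only [gibbs_eq π ξ η hπ0 hπ1, ← Finset.sum_div]
  exact div_self (partition_pos π ξ η hπ0 hπ1 θ τ).ne'

/-- the derivative functional of the log-density -/
noncomputable def dlog (x y : ℝ) : ℝ × ℝ →L[ℝ] ℝ :=
  x • ContinuousLinearMap.fst ℝ ℝ ℝ + y • ContinuousLinearMap.snd ℝ ℝ ℝ

theorem gibbs_hasFDerivAt {S : Type*} [Fintype S] (π : S → ℝ) (ξ η : S → ℤ)
    (hπ0 : ∀ ω : S, 0 ≤ π ω) (hπ1 : ∑ ω : S, π ω = 1) (p : ℝ × ℝ) (ω : S) :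
    HasFDerivAt (fun q : ℝ × ℝ => gibbsMeasure π ξ η q.1 q.2 ω)
      (gibbsMeasure π ξ η p.1 p.2 ω •
        dlog (ξ ω - ∑ a, gibbsMeasure π ξ η p.1 p.2 a * ξ a)
          (η ω - ∑ a, gibbsMeasure π ξ η p.1 p.2 a * η a)) p := by
  have hZ := partition_pos π ξ η hπ0 hπ1 p.1 p.2
  have hlin : ∀ a : S, HasFDerivAt (fun q : ℝ × ℝ => q.1 * (ξ a : ℝ) + q.2 * (η a : ℝ))
      (dlog (ξ a) (η a)) p := by
    intro a
    exact (hasFDerivAt_fst.mul_const _).add (hasFDerivAt_snd.mul_const _)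
  have hsum := HasFDerivAt.fun_sum (u := Finset.univ)
    fun a (_ : a ∈ Finset.univ) => ((hlin a).exp.mul_const (π a))
  have h := (((hlin ω).sub (hsum.log hZ.ne')).exp.const_mul (π ω))
  refine HasFDerivAt.congr_fderiv (f := fun q : ℝ × ℝ => gibbsMeasure π ξ η q.1 q.2 ω) h ?_
  ext <;> simp [dlog, gibbs_eq π ξ η hπ0 hπ1, Real.exp_sub, Real.exp_log hZ]
  all_goals
    generalize (∑ i, Real.exp (p.1 * (ξ i : ℝ) + p.2 * (η i : ℝ)) * π i) = Z
    rw [Finset.mul_sum, mul_comm (Real.exp _) (π ω), mul_div_assoc, mul_assoc]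
    congr 3
    refine Finset.sum_congr rfl fun x _ => ?_
    ring

theorem flux_hasFDerivAt {S : Type*} [Fintype S] (r : S → S → S → S → ℝ)
    (π : S → ℝ) (ξ η g : S → ℤ)
    (hπ0 : ∀ ω : S, 0 ≤ π ω) (hπ1 : ∑ ω : S, π ω = 1) (p : ℝ × ℝ) :
    ∃ L : ℝ × ℝ →L[ℝ] ℝ, HasFDerivAt (macroFlux r π ξ η g) L p ∧ ∀ v : ℝ × ℝ, L v =
      ∑ a, ∑ b, (∑ c, ∑ d, r a b c d * ((g d : ℝ) - (g b : ℝ))) *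
        gibbsMeasure π ξ η p.1 p.2 a * gibbsMeasure π ξ η p.1 p.2 b *
        (dlog (ξ a - ∑ a, gibbsMeasure π ξ η p.1 p.2 a * ξ a)
          (η a - ∑ a, gibbsMeasure π ξ η p.1 p.2 a * η a) v
        + dlog (ξ b - ∑ a, gibbsMeasure π ξ η p.1 p.2 a * ξ a)
          (η b - ∑ a, gibbsMeasure π ξ η p.1 p.2 a * η a) v) := by
  have hg := gibbs_hasFDerivAt π ξ η hπ0 hπ1 p
  have h := HasFDerivAt.fun_sum (u := Finset.univ) fun a (_ : a ∈ Finset.univ) =>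
    HasFDerivAt.fun_sum (u := Finset.univ) fun b (_ : b ∈ Finset.univ) =>
      (((hg a).const_mul (∑ c, ∑ d, r a b c d * ((g d : ℝ) - (g b : ℝ)))).mul (hg b))
  refine ⟨_, h, fun v => ?_⟩
  rw [ContinuousLinearMap.sum_apply]
  refine Finset.sum_congr rfl fun a _ => ?_
  rw [ContinuousLinearMap.sum_apply]
  refine Finset.sum_congr rfl fun b _ => ?_
  simp only [ContinuousLinearMap.add_apply, ContinuousLinearMap.smul_apply, smul_eq_mul]
  ring

theorem gibbs_rev {S : Type*} [Fintype S]
    (ξ η : S → ℤ) (r : S → S → S → S → ℝ) (π : S → ℝ)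
    (hr : ∀ ω₁ ω₂ ω₁' ω₂' : S, 0 ≤ r ω₁ ω₂ ω₁' ω₂')
    (hA : ∀ ω₁ ω₂ ω₁' ω₂' : S, 0 < r ω₁ ω₂ ω₁' ω₂' →
      ξ ω₁ + ξ ω₂ = ξ ω₁' + ξ ω₂' ∧ η ω₁ + η ω₂ = η ω₁' + η ω₂')
    (hC : ∀ ω₁ ω₂ ω₁' ω₂' : S,
      π ω₁ * π ω₂ * r ω₁ ω₂ ω₁' ω₂' = π ω₂' * π ω₁' * r ω₂' ω₁' ω₂ ω₁) (θ τ : ℝ)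
    (a b c d : S) :
    gibbsMeasure π ξ η θ τ a * gibbsMeasure π ξ η θ τ b * r a b c d
      = gibbsMeasure π ξ η θ τ d * gibbsMeasure π ξ η θ τ c * r d c b a := by
  unfold gibbsMeasure
  generalize Real.log _ = G
  have key : 0 < r a b c d ∨ 0 < r d c b a →
      Real.exp (θ * ξ a + τ * η a - G) * Real.exp (θ * ξ b + τ * η b - G)
      = Real.exp (θ * ξ d + τ * η d - G) * Real.exp (θ * ξ c + τ * η c - G) := by
    intro h
    have h' : ξ a + ξ b = ξ c + ξ d ∧ η a + η b = η c + η d := by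
      rcases h with h | h
      · exact hA _ _ _ _ h
      · have := hA _ _ _ _ h
        omega
    have e1 : (ξ a : ℝ) + ξ b = ξ c + ξ d := by exact_mod_cast h'.1
    have e2 : (η a : ℝ) + η b = η c + η d := by exact_mod_cast h'.2
    rw [← Real.exp_add, ← Real.exp_add]
    congr 1
    linear_combination θ * e1 + τ * e2
  by_cases h : 0 < r a b c d ∨ 0 < r d c b a
  · have k := key h
    have c1 := hC a b c d
    linear_combination (π a * π b * r a b c d) * k +
      (Real.exp (θ * ξ d + τ * η d - G) * Real.exp (θ * ξ c + τ * η c - G)) * c1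
  · push Not at h
    rw [le_antisymm h.1 (hr _ _ _ _), le_antisymm h.2 (hr _ _ _ _)]
    simp

/-- the Onsager-type identity `∂Φ/∂τ = ∂Ψ/∂θ`. -/
theorem onsager_identity {S : Type*} [Fintype S]
    (ξ η : S → ℤ) (r : S → S → S → S → ℝ) (π : S → ℝ)
    (hr : ∀ ω₁ ω₂ ω₁' ω₂' : S, 0 ≤ r ω₁ ω₂ ω₁' ω₂')
    (hA : ∀ ω₁ ω₂ ω₁' ω₂' : S, 0 < r ω₁ ω₂ ω₁' ω₂' →
      ξ ω₁ + ξ ω₂ = ξ ω₁' + ξ ω₂' ∧ η ω₁ + η ω₂ = η ω₁' + η ω₂')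
    (hπ0 : ∀ ω : S, 0 ≤ π ω) (hπ1 : ∑ ω : S, π ω = 1)
    (hC : ∀ ω₁ ω₂ ω₁' ω₂' : S,
      π ω₁ * π ω₂ * r ω₁ ω₂ ω₁' ω₂' = π ω₂' * π ω₁' * r ω₂' ω₁' ω₂ ω₁)
    (hD : ∀ ω₁ ω₂ ω₃ : S,
      (∑ ω₁' : S, ∑ ω₂' : S, r ω₁ ω₂ ω₁' ω₂')
        + (∑ ω₁' : S, ∑ ω₂' : S, r ω₂ ω₃ ω₁' ω₂')
        + (∑ ω₁' : S, ∑ ω₂' : S, r ω₃ ω₁ ω₁' ω₂')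
      = (∑ ω₁' : S, ∑ ω₂' : S, r ω₁ ω₃ ω₁' ω₂')
        + (∑ ω₁' : S, ∑ ω₂' : S, r ω₃ ω₂ ω₁' ω₂')
        + (∑ ω₁' : S, ∑ ω₂' : S, r ω₂ ω₁ ω₁' ω₂')) :
    Differentiable ℝ (macroFlux r π ξ η ξ) ∧
    Differentiable ℝ (macroFlux r π ξ η η) ∧
    ∀ p : ℝ × ℝ,
      fderiv ℝ (macroFlux r π ξ η ξ) p (0, 1) =
        fderiv ℝ (macroFlux r π ξ η η) p (1, 0) := by
  have hd := fun g => flux_hasFDerivAt r π ξ η g hπ0 hπ1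
  refine ⟨fun p => ?_, fun p => ?_, fun p => ?_⟩
  · obtain ⟨L, hL, -⟩ := hd ξ p
    exact hL.differentiableAt
  · obtain ⟨L, hL, -⟩ := hd η p
    exact hL.differentiableAt
  obtain ⟨L, hL, hLv⟩ := hd ξ p
  obtain ⟨M, hM, hMv⟩ := hd η p
  rw [hL.fderiv, hM.fderiv, hLv, hMv]
  have hne : Nonempty S := by
    by_contra h
    rw [not_nonempty_iff] at h
    simp at hπ1
  have hrev := gibbs_rev ξ η r π hr hA hC p.1 p.2
  have hs := gibbs_sum π ξ η hπ0 hπ1 p.1 p.2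
  generalize gibbsMeasure π ξ η p.1 p.2 = m at hrev hs ⊢
  have cons : ∀ a b c d, ∀ e : ℝ,
      r a b c d * (((ξ a : ℝ) - e) + (ξ b - e)) = r a b c d * ((ξ c - e) + (ξ d - e)) ∧
      r a b c d * (((η a : ℝ) - e) + (η b - e)) = r a b c d * ((η c - e) + (η d - e)) := by
    intro a b c d e
    rcases (hr a b c d).eq_or_lt with h | h
    · simp [← h]
    · obtain ⟨h1, h2⟩ := hA _ _ _ _ h
      have e1 : (ξ a : ℝ) + ξ b = ξ c + ξ d := by exact_mod_cast h1
      have e2 : (η a : ℝ) + η b = η c + η d := by exact_mod_cast h2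
      constructor
      · linear_combination (r a b c d) * e1
      · linear_combination (r a b c d) * e2
  have cent : ∀ g : S → ℤ, ∑ a, m a * ((g a : ℝ) - ∑ b, m b * g b) = 0 := by
    intro g
    simp only [mul_sub, Finset.sum_sub_distrib, ← Finset.sum_mul, hs]
    ring
  set X : S → ℝ := fun a => (ξ a : ℝ) - ∑ b, m b * ξ b with hX
  set Y : S → ℝ := fun a => (η a : ℝ) - ∑ b, m b * η b with hY
  have f1 := flux_step r m X Y (fun a b c d => (cons a b c d _).2) hrev
  have f2 := flux_step r m Y X (fun a b c d => (cons a b c d _).1) hrev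
  have f3 := antisymm_step (fun a b => ∑ c, ∑ d, r a b c d) m X Y hD (cent ξ) (cent η)
  have f := f1.trans (f3.trans f2.symm)
  simp only [hX, hY, sub_sub_sub_cancel_right] at f
  simpa [dlog] using f
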